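/- Let G be a nontrivial connected graph of order n. Then κ(G) ≤ κ⁺(G) ≤ rvd(G) ≤ n, where κ(G) is the connectivity of G and κ⁺(G) is the upper connectivity of G. -/

import Mathlib

open SimpleGraph

/-- A set of vertices is rainbow under a coloring `c` if no two of its vertices
receive the same color. -/
def RainbowSet {V : Type*} (c : V → ℕ) (S : Set V) : Prop := Set.InjOn c S

/-- `c` is a rainbow vertex-disconnection coloring of `G`: for every two distinct
vertices `x, y` there is a set `S` avoiding `x` and `y` such that every `x`-`y` walk
in `G - xy` (which is `G` itself when `x, y` are nonadjacent) meets `S` (i.e. `S` is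
an `x`-`y` vertex-cut), and moreover `S` is rainbow when `x, y` are nonadjacent,
while `S ∪ {x}` or `S ∪ {y}` is rainbow when `x, y` are adjacent. -/
def IsRVDColoring {V : Type*} (G : SimpleGraph V) (c : V → ℕ) : Prop :=
  ∀ x y : V, x ≠ y → ∃ S : Set V, x ∉ S ∧ y ∉ S ∧
    (∀ p : (G.deleteEdges {s(x, y)}).Walk x y, ∃ v ∈ p.support, v ∈ S) ∧
    (¬ G.Adj x y → RainbowSet c S) ∧
    (G.Adj x y → (RainbowSet c (insert x S) ∨ RainbowSet c (insert y S)))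

/-- The rainbow vertex-disconnection number `rvd G`: the minimum number of colors
used by a rainbow vertex-disconnection coloring of `G`. -/
noncomputable def rvd {V : Type*} (G : SimpleGraph V) : ℕ :=
  sInf {k | ∃ c : V → ℕ, IsRVDColoring G c ∧ (Set.range c).ncard = k}

open scoped Classical in
/-- The local connectivity `κ_G(x, y)`: for nonadjacent `x, y`, the minimum number of
vertices (other than `x, y`) separating `x` from `y`; for adjacent `x, y`, it is
`κ_{G - xy}(x, y) + 1`. -/
noncomputable def localConn {V : Type*} (G : SimpleGraph V) (x y : V) : ℕ :=
  sInf {k | ∃ S : Set V, x ∉ S ∧ y ∉ S ∧ S.ncard = k ∧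
      ∀ p : (G.deleteEdges {s(x, y)}).Walk x y, ∃ v ∈ p.support, v ∈ S} +
    (if G.Adj x y then 1 else 0)

/-- The connectivity `κ(G)`: the minimum number of vertices whose removal results in
a disconnected graph or a trivial (one-vertex) graph. -/
noncomputable def graphConn {V : Type*} (G : SimpleGraph V) : ℕ :=
  sInf {k | ∃ S : Set V, S.ncard = k ∧
    (¬ (G.induce Sᶜ).Connected ∨ (Sᶜ : Set V).ncard = 1)}

/-- The upper connectivity `κ⁺(G)`: the maximum of `κ_G(x, y)` over pairs of distinct
vertices. -/
noncomputable def upperConn {V : Type*} (G : SimpleGraph V) : ℕ :=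
  sSup {k | ∃ x y : V, x ≠ y ∧ localConn G x y = k}

/-- Every walk between distinct vertices avoiding the edge joining them has an interior vertex. -/
lemma exists_mem_support_compl_pair {V : Type*} (G : SimpleGraph V) {x y : V} (hxy : x ≠ y)
    (p : (G.deleteEdges {s(x, y)}).Walk x y) : ∃ v ∈ p.support, v ∈ ({x, y} : Set V)ᶜ := by
  cases p with
  | nil => exact absurd rfl hxy
  | @cons _ z _ h q =>
    refine ⟨z, by simp, ?_⟩
    rw [SimpleGraph.deleteEdges_adj] at h
    rintro (rfl | rfl)
    · exact G.irrefl h.1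
    · exact h.2 rfl

lemma exists_ncard_add_eq_localConn {V : Type*} (G : SimpleGraph V) {x y : V} (hxy : x ≠ y) :
    ∃ S : Set V, x ∉ S ∧ y ∉ S ∧
      (∀ p : (G.deleteEdges {s(x, y)}).Walk x y, ∃ v ∈ p.support, v ∈ S) ∧
      (G.Adj x y → localConn G x y = S.ncard + 1) ∧
      (¬ G.Adj x y → localConn G x y = S.ncard) := by
  have hne : {k | ∃ S : Set V, x ∉ S ∧ y ∉ S ∧ S.ncard = k ∧
      ∀ p : (G.deleteEdges {s(x, y)}).Walk x y, ∃ v ∈ p.support, v ∈ S}.Nonempty :=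
    ⟨_, {x, y}ᶜ, by simp, by simp, rfl, exists_mem_support_compl_pair G hxy⟩
  obtain ⟨S, hx, hy, hS, hcut⟩ := Nat.sInf_mem hne
  exact ⟨S, hx, hy, hcut, fun h => by simp [localConn, h, hS],
    fun h => by simp [localConn, h, hS]⟩

lemma localConn_le_ncard_add {V : Type*} (G : SimpleGraph V) {x y : V} {S : Set V}
    (hx : x ∉ S) (hy : y ∉ S)
    (hcut : ∀ p : (G.deleteEdges {s(x, y)}).Walk x y, ∃ v ∈ p.support, v ∈ S) :
    (G.Adj x y → localConn G x y ≤ S.ncard + 1) ∧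
      (¬ G.Adj x y → localConn G x y ≤ S.ncard) := by
  have h := Nat.sInf_le (s := {k | ∃ S : Set V, x ∉ S ∧ y ∉ S ∧ S.ncard = k ∧
      ∀ p : (G.deleteEdges {s(x, y)}).Walk x y, ∃ v ∈ p.support, v ∈ S}) ⟨S, hx, hy, rfl, hcut⟩
  constructor <;> intro ha <;> simpa [localConn, ha] using h

lemma RainbowSet.ncard_le {V : Type*} [Finite V] {c : V → ℕ} {S : Set V} (h : RainbowSet c S) :
    S.ncard ≤ (Set.range c).ncard :=
  Set.ncard_le_ncard_of_injOn c (fun v _ => Set.mem_range_self v) h (Set.finite_range c)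

lemma IsRVDColoring.localConn_le {V : Type*} [Finite V] {G : SimpleGraph V} {c : V → ℕ}
    (hc : IsRVDColoring G c) {x y : V} (hxy : x ≠ y) :
    localConn G x y ≤ (Set.range c).ncard := by
  obtain ⟨S, hx, hy, hcut, hnadj, hadj⟩ := hc x y hxy
  have hle := localConn_le_ncard_add G hx hy hcut
  by_cases ha : G.Adj x y
  · refine (hle.1 ha).trans ?_
    rcases hadj ha with h | h
    · rw [← Set.ncard_insert_of_notMem hx]
      exact h.ncard_le
    · rw [← Set.ncard_insert_of_notMem hy]
      exact h.ncard_le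
  · exact (hle.2 ha).trans (hnadj ha).ncard_le

lemma isRVDColoring_of_injective {V : Type*} (G : SimpleGraph V) {c : V → ℕ}
    (hc : Function.Injective c) : IsRVDColoring G c := fun x y hxy =>
  ⟨{x, y}ᶜ, by simp, by simp, exists_mem_support_compl_pair G hxy, fun _ => hc.injOn,
    fun _ => Or.inl hc.injOn⟩

lemma exists_isRVDColoring_ncard_range_eq_card {V : Type*} [Fintype V] (G : SimpleGraph V) :
    ∃ c : V → ℕ, IsRVDColoring G c ∧ (Set.range c).ncard = Fintype.card V := by
  have hinj : Function.Injective fun v => (Fintype.equivFin V v : ℕ) :=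
    Fin.val_injective.comp (Fintype.equivFin V).injective
  refine ⟨_, isRVDColoring_of_injective G hinj, ?_⟩
  rw [← Set.image_univ, Set.ncard_image_of_injective _ hinj, Set.ncard_univ,
    Nat.card_eq_fintype_card]

lemma rvd_le_card {V : Type*} [Fintype V] (G : SimpleGraph V) : rvd G ≤ Fintype.card V :=
  Nat.sInf_le (exists_isRVDColoring_ncard_range_eq_card G)

lemma localConn_le_rvd {V : Type*} [Fintype V] (G : SimpleGraph V) {x y : V} (hxy : x ≠ y) :
    localConn G x y ≤ rvd G := by
  obtain ⟨c, hc, hk⟩ := Nat.sInf_mem (s := {k | ∃ c : V → ℕ, IsRVDColoring G c ∧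
    (Set.range c).ncard = k}) ⟨_, exists_isRVDColoring_ncard_range_eq_card G⟩
  exact (hc.localConn_le hxy).trans hk.le

lemma localConn_le_upperConn {V : Type*} [Fintype V] (G : SimpleGraph V) {x y : V}
    (hxy : x ≠ y) : localConn G x y ≤ upperConn G := by
  refine le_csSup ⟨rvd G, ?_⟩ ⟨x, y, hxy, rfl⟩
  rintro _ ⟨u, v, huv, rfl⟩
  exact localConn_le_rvd G huv

lemma graphConn_le_localConn_of_not_adj {V : Type*} (G : SimpleGraph V) {x y : V} (hxy : x ≠ y)
    (ha : ¬ G.Adj x y) : graphConn G ≤ localConn G x y := by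
  obtain ⟨S, hx, hy, hcut, -, hS⟩ := exists_ncard_add_eq_localConn G hxy
  rw [hS ha]
  refine Nat.sInf_le ⟨S, rfl, Or.inl fun hconn => ?_⟩
  obtain ⟨p⟩ := hconn.preconnected ⟨x, hx⟩ ⟨y, hy⟩
  rw [SimpleGraph.deleteEdges_eq_self.mpr (by simpa using ha)] at hcut
  obtain ⟨v, hv, hvS⟩ := hcut (p.map (SimpleGraph.Embedding.induce Sᶜ).toHom)
  obtain ⟨w, -, rfl⟩ := List.mem_map.mp ((SimpleGraph.Walk.support_map _ p) ▸ hv :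
    v ∈ p.support.map (SimpleGraph.Embedding.induce Sᶜ).toHom)
  exact w.2 hvS

lemma card_le_localConn_add_one {V : Type*} [Fintype V] {G : SimpleGraph V}
    (hG : ∀ u v, u ≠ v → G.Adj u v) {x y : V} (hxy : x ≠ y) :
    Fintype.card V ≤ localConn G x y + 1 := by
  obtain ⟨S, hx, hy, hcut, hS, -⟩ := exists_ncard_add_eq_localConn G hxy
  have hsub : ({x, y} : Set V)ᶜ ⊆ S := by
    intro z hz
    have hzx : z ≠ x := fun h => hz (Or.inl h)
    have hzy : z ≠ y := fun h => hz (Or.inr h)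
    have hxz : (G.deleteEdges {s(x, y)}).Adj x z := by
      simp [hG x z hzx.symm, hzy, hxy]
    have hzy' : (G.deleteEdges {s(x, y)}).Adj z y := by
      simp [hG z y hzy, hzx, hzy]
    obtain ⟨v, hv, hvS⟩ := hcut (.cons hxz (.cons hzy' .nil))
    simp only [SimpleGraph.Walk.support_cons, SimpleGraph.Walk.support_nil, List.mem_cons,
      List.not_mem_nil, or_false] at hv
    rcases hv with rfl | rfl | rfl
    · exact absurd hvS hx
    · exact hvS
    · exact absurd hvS hy
  have hle := Set.ncard_le_ncard hsub
  have hadd := Set.ncard_add_ncard_compl ({x, y} : Set V)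
  rw [Set.ncard_pair hxy, Nat.card_eq_fintype_card] at hadd
  rw [hS (hG x y hxy)]
  omega

lemma graphConn_add_one_le_card {V : Type*} [Fintype V] [Nonempty V] (G : SimpleGraph V) :
    graphConn G + 1 ≤ Fintype.card V := by
  obtain ⟨v⟩ := ‹Nonempty V›
  have h : graphConn G ≤ ({v}ᶜ : Set V).ncard := Nat.sInf_le ⟨{v}ᶜ, rfl, Or.inr (by simp)⟩
  have hadd := Set.ncard_add_ncard_compl ({v} : Set V)
  rw [Set.ncard_singleton, Nat.card_eq_fintype_card] at hadd
  omega

lemma graphConn_le_upperConn {V : Type*} [Fintype V] [Nontrivial V] (G : SimpleGraph V) :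
    graphConn G ≤ upperConn G := by
  by_cases hG : ∀ u v, u ≠ v → G.Adj u v
  · obtain ⟨x, y, hxy⟩ := exists_pair_ne V
    have := card_le_localConn_add_one hG hxy
    have := graphConn_add_one_le_card G
    have := localConn_le_upperConn G hxy
    omega
  · push Not at hG
    obtain ⟨x, y, hxy, ha⟩ := hG
    exact (graphConn_le_localConn_of_not_adj G hxy ha).trans (localConn_le_upperConn G hxy)

lemma upperConn_le_rvd {V : Type*} [Fintype V] [Nontrivial V] (G : SimpleGraph V) :
    upperConn G ≤ rvd G := by
  obtain ⟨x, y, hxy⟩ := exists_pair_ne V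
  refine csSup_le ⟨_, x, y, hxy, rfl⟩ ?_
  rintro _ ⟨u, v, huv, rfl⟩
  exact localConn_le_rvd G huv

/-- For a nontrivial connected graph `G` of order `n`:
`κ(G) ≤ κ⁺(G) ≤ rvd(G) ≤ n`. -/
theorem stmt4 {V : Type*} [Fintype V] (G : SimpleGraph V) (hG : G.Connected)
    (hn : 2 ≤ Fintype.card V) :
    graphConn G ≤ upperConn G ∧ upperConn G ≤ rvd G ∧ rvd G ≤ Fintype.card V := by
  have : Nontrivial V := Fintype.one_lt_card_iff_nontrivial.mp hn
  exact ⟨graphConn_le_upperConn G, upperConn_le_rvd G, rvd_le_card G⟩
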